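/- For every squarefree positive integer d with d ∉ {1, 3}, the Bianchi group PSL₂(O_d) is an HNN extension with amalgamated subgroup isomorphic to PSL₂(ℤ): there exist a group H, subgroups A and B of H with A isomorphic to PSL₂(ℤ), and an isomorphism φ : A ≅ B, such that PSL₂(O_d) is isomorphic to the HNN extension of H with associated subgroups A, B and identifying isomorphism φ. -/

import Mathlib

open IntermediateField

/-- The imaginary quadratic field `ℚ(√-d)`, realized inside `ℂ`. -/
noncomputable abbrev Qd (d : ℕ) : IntermediateField ℚ ℂ :=
  ℚ⟮(Complex.I * (Real.sqrt d : ℂ) : ℂ)⟯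

/-- `O_d`: the ring of integers of the imaginary quadratic field `ℚ(√-d)`. -/
noncomputable abbrev Od (d : ℕ) : Type :=
  NumberField.RingOfIntegers (Qd d)

/-- `SL₂(R)`: the special linear group of 2×2 matrices over `R` of determinant 1. -/
abbrev SL2 (R : Type*) [CommRing R] : Type _ :=
  Matrix.SpecialLinearGroup (Fin 2) R

/-- `PSL₂(R)`: the quotient of `SL₂(R)` by its center. -/
abbrev PSL2 (R : Type*) [CommRing R] : Type _ :=
  SL2 R ⧸ Subgroup.center (SL2 R)
/-- A group `G` with a subgroup `A` and an element `t`, together with the combinatorics of a tree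
whose edges are the cosets `g A`: `σ g` records on which side of the edge `g A` the base vertex
lies, so that `σ (x * g)` is the side of `g A` containing the vertex obtained by applying `x⁻¹` to
the base vertex. The base vertex and its translate by `t` are the two ends of the edge `t A`. -/
structure IsEdgeSide {G : Type*} [Group G] (A : Subgroup G) (t : G) (σ : G → Bool) : Prop where
  apply_mul : ∀ g, ∀ a ∈ A, σ (g * a) = σ g
  one : σ 1 = true
  stable : σ t = false
  adjacent : ∀ g, g ∉ A → σ (t * g) = σ g
  nested : ∀ g, g ∉ A → ∃ a b, ∀ x, ¬(σ x = a ∧ σ (x * g) = b)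

/-- The stabilizer of the base vertex. -/
def vertexStabilizer {G : Type*} [Group G] (σ : G → Bool) : Subgroup G where
  carrier := {h | ∀ g, σ (h * g) = σ g}
  one_mem' g := by simp
  mul_mem' {a b} ha hb g := by rw [mul_assoc, ha, hb]
  inv_mem' {a} ha g := by rw [← ha, mul_inv_cancel_left]

/-- The edge `g A` is incident with the base vertex: some vertex is separated from the base vertex
by the edge `g A` only. -/
def IsIncident {G : Type*} [Group G] (A : Subgroup G) (σ : G → Bool) (g : G) : Prop :=
  ∃ x, σ (x * g) ≠ σ g ∧ ∀ g', g⁻¹ * g' ∉ A → σ (x * g') = σ g'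

namespace IsEdgeSide

variable {G : Type*} [Group G] {A : Subgroup G} {t : G} {σ : G → Bool}

theorem apply_of_mem (S : IsEdgeSide A t σ) {a : G} (ha : a ∈ A) : σ a = true := by
  rw [← S.one, ← S.apply_mul 1 a ha, one_mul]

theorem adjacent_inv (S : IsEdgeSide A t σ) {g : G} (hg : t⁻¹ * g ∉ A) : σ (t⁻¹ * g) = σ g := by
  rw [← S.adjacent _ hg, mul_inv_cancel_left]

theorem apply_vertex (S : IsEdgeSide A t σ) {h : G} (hh : h ∈ vertexStabilizer σ) :
    σ h = true := by
  rw [← S.one, ← hh 1, mul_one]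

theorem le_vertexStabilizer (S : IsEdgeSide A t σ) : A ≤ vertexStabilizer σ := by
  suffices ∀ a ∈ A, ∀ g, σ (a⁻¹ * g) = σ g by
    intro a ha g
    simpa using this a⁻¹ (inv_mem ha) g
  intro a ha g
  by_cases hg : g ∈ A
  · rw [S.apply_of_mem hg, S.apply_of_mem (mul_mem (inv_mem ha) hg)]
  have hag : a⁻¹ * g ∉ A := by rwa [Subgroup.mul_mem_cancel_left _ (inv_mem ha)]
  obtain ⟨b, c, hbc⟩ := S.nested g hg
  have e1 := hbc 1
  have e2 := hbc a⁻¹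
  have e3 := hbc t
  have e4 := hbc (t * a⁻¹)
  rw [S.one, one_mul] at e1
  rw [S.apply_of_mem (inv_mem ha)] at e2
  rw [S.stable, S.adjacent g hg] at e3
  rw [S.apply_mul t _ (inv_mem ha), S.stable, mul_assoc, S.adjacent _ hag] at e4
  clear hbc
  generalize σ g = p, σ (a⁻¹ * g) = q at *
  revert b c p q
  decide

theorem conj_mem_vertexStabilizer (S : IsEdgeSide A t σ) {a : G} (ha : a ∈ A) :
    t * a * t⁻¹ ∈ vertexStabilizer σ := by
  intro g
  by_cases hg : t⁻¹ * g ∈ A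
  · obtain ⟨b, hb, rfl⟩ : ∃ b ∈ A, g = t * b := ⟨_, hg, by group⟩
    rw [show t * a * t⁻¹ * (t * b) = t * (a * b) by group, S.apply_mul _ _ hb,
      S.apply_mul _ _ (mul_mem ha hb)]
  · have hag : a * (t⁻¹ * g) ∉ A := by rwa [Subgroup.mul_mem_cancel_left _ ha]
    rw [show t * a * t⁻¹ * g = t * (a * (t⁻¹ * g)) by group, S.adjacent _ hag,
      S.le_vertexStabilizer ha, S.adjacent_inv hg]

theorem isIncident_one (S : IsEdgeSide A t σ) : IsIncident A σ 1 :=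
  ⟨t, by simp [S.one, S.stable], fun g hg ↦ S.adjacent g (by simpa using hg)⟩

theorem isIncident_stable (S : IsEdgeSide A t σ) : IsIncident A σ t :=
  ⟨t⁻¹, by simp [S.one, S.stable], fun _ hg ↦ S.adjacent_inv hg⟩

theorem far_sides_disjoint (S : IsEdgeSide A t σ) {g₁ g₂ : G} (h₁ : IsIncident A σ g₁)
    (h₂ : IsIncident A σ g₂) (h : g₁⁻¹ * g₂ ∉ A) {x : G} (hx : σ (x * g₁) ≠ σ g₁) :
    σ (x * g₂) = σ g₂ := by
  obtain ⟨x₁, hx₁, hx₁'⟩ := h₁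
  obtain ⟨x₂, hx₂, hx₂'⟩ := h₂
  replace hx₁' := hx₁' g₂ h
  replace hx₂' := hx₂' g₁ (by rwa [← inv_mem_iff, mul_inv_rev, inv_inv])
  obtain ⟨a, b, hab⟩ := S.nested _ h
  have key : ∀ y, ¬(σ (y * g₁) = a ∧ σ (y * g₂) = b) := fun y ↦ by
    simpa [mul_assoc] using hab (y * g₁)
  have e0 := key 1
  have e1 := key x₁
  have e2 := key x₂
  have e3 := key x
  rw [one_mul, one_mul] at e0
  rw [Bool.eq_not_of_ne hx₁, hx₁'] at e1
  rw [hx₂', Bool.eq_not_of_ne hx₂] at e2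
  rw [Bool.eq_not_of_ne hx] at e3
  clear hab key
  generalize σ g₁ = p, σ g₂ = q, σ (x * g₂) = r at e0 e1 e2 e3 ⊢
  revert a b p q r
  decide

end IsEdgeSide

theorem IsIncident.mul_left {G : Type*} [Group G] {A : Subgroup G} {σ : G → Bool} {g h : G}
    (hg : IsIncident A σ g) (hh : h ∈ vertexStabilizer σ) : IsIncident A σ (h * g) := by
  obtain ⟨x, hx, hx'⟩ := hg
  refine ⟨x * h⁻¹, ?_, fun g' hg' ↦ ?_⟩
  · rwa [hh, show x * h⁻¹ * (h * g) = x * g by group]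
  · rw [mul_assoc, hx', inv_mem hh]
    simpa [mul_assoc] using hg'

namespace IsEdgeSide

variable {G : Type*} [Group G] {A : Subgroup G} {t : G} {σ : G → Bool}

/-- A group with a function to `ℕ` that decreases when an edge is inserted strictly between two
edges is generated by the vertex stabilizer and `t`, if it contains the elements at which the
decrease fails. -/
theorem mem_closure_of_between (S : IsEdgeSide A t σ) (N : G → ℕ)
    (hN : ∀ g, g ∈ Subgroup.closure (insert t (A : Set G)) ∨
      ∀ u (a b c : Bool) (x₁ x₂ x₃ x₄ : G),
        (σ x₁ = !a) → (σ (x₁ * u) = !b) → (σ (x₁ * g) = !c) →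
        (σ x₂ = a) → (σ (x₂ * u) = !b) → (σ (x₂ * g) = !c) →
        (σ x₃ = a) → (σ (x₃ * u) = b) → (σ (x₃ * g) = !c) →
        (σ x₄ = a) → (σ (x₄ * u) = b) → (σ (x₄ * g) = c) →
        N u < N g ∧ N (u⁻¹ * g) < N g) (g : G) :
    g ∈ Subgroup.closure (insert t (vertexStabilizer σ : Set G)) := by
  have htK : t ∈ Subgroup.closure (insert t (vertexStabilizer σ : Set G)) :=
    Subgroup.subset_closure (Set.mem_insert _ _)
  have hHK : vertexStabilizer σ ≤ Subgroup.closure (insert t (vertexStabilizer σ : Set G)) :=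
    fun x hx ↦ Subgroup.subset_closure (Set.mem_insert_of_mem _ hx)
  have hAK : Subgroup.closure (insert t (A : Set G)) ≤
      Subgroup.closure (insert t (vertexStabilizer σ : Set G)) :=
    Subgroup.closure_mono (Set.insert_subset_insert S.le_vertexStabilizer)
  induction hn : N g using Nat.strong_induction_on generalizing g with
  | _ n ih =>
  subst hn
  rcases hN g with hg | hg
  · exact hAK hg
  by_cases hgA : g ∈ A
  · exact hHK (S.le_vertexStabilizer hgA)
  have hgA' : g⁻¹ ∉ A := by rwa [inv_mem_iff]
  obtain ⟨na, c, hac⟩ := S.nested g hgA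
  obtain ⟨a, rfl⟩ : ∃ a, na = !a := ⟨!na, by simp⟩
  obtain ⟨x₁, x₂, hx₁, hx₂, hx₂K, hx⟩ : ∃ x₁ x₂, (σ x₁ = !a) ∧ σ x₂ = a ∧
      (x₂ = 1 ∨ x₂ = t) ∧ ∀ u ∉ A, σ (x₁ * u) = σ (x₂ * u) := by
    cases a
    · exact ⟨1, t, S.one, S.stable, Or.inr rfl, fun u hu ↦ by rw [S.adjacent u hu, one_mul]⟩
    · exact ⟨t, 1, S.stable, S.one, Or.inl rfl, fun u hu ↦ by rw [S.adjacent u hu, one_mul]⟩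
  obtain ⟨x₃, x₄, hx₃, hx₄, hx₃K, hx'⟩ : ∃ x₃ x₄, (σ (x₃ * g) = !c) ∧ σ (x₄ * g) = c ∧
      (x₃ = g⁻¹ ∨ x₃ = t * g⁻¹) ∧ ∀ u, g⁻¹ * u ∉ A → σ (x₃ * u) = σ (x₄ * u) := by
    cases c
    · exact ⟨g⁻¹, t * g⁻¹, by simp [S.one], by simp [S.stable], Or.inl rfl,
        fun u hu ↦ by rw [mul_assoc, S.adjacent _ hu]⟩
    · exact ⟨t * g⁻¹, g⁻¹, by simp [S.stable], by simp [S.one], Or.inr rfl,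
        fun u hu ↦ by rw [mul_assoc, S.adjacent _ hu]⟩
  have hx₁g : σ (x₁ * g) = !c := by
    have := hac x₁
    rw [hx₁] at this
    exact Bool.eq_not_of_ne fun h ↦ this ⟨rfl, h⟩
  have hx₂g : σ (x₂ * g) = !c := by rw [← hx g hgA, hx₁g]
  have hx₄' : σ x₄ = a := by
    have := hac x₄
    rw [hx₄] at this
    rw [← Bool.not_not a]
    exact Bool.eq_not_of_ne fun h ↦ this ⟨h, rfl⟩
  have hx₃' : σ x₃ = a := by simpa [hx₄'] using hx' 1 (by simpa using hgA)
  by_cases hall : ∀ u, σ (x₂ * u) = σ (x₃ * u)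
  · have hmem : x₂ * x₃⁻¹ ∈ vertexStabilizer σ := fun u ↦ by
      rw [mul_assoc, hall, mul_inv_cancel_left]
    have hx₂K' : x₂ ∈ Subgroup.closure (insert t (vertexStabilizer σ : Set G)) := by
      rcases hx₂K with rfl | rfl
      exacts [one_mem _, htK]
    have hx₃K' : x₃ ∈ Subgroup.closure (insert t (vertexStabilizer σ : Set G)) := by
      simpa using mul_mem (inv_mem (hHK hmem)) hx₂K'
    rcases hx₃K with h | h
    · rwa [h, inv_mem_iff] at hx₃K'
    · rwa [h, Subgroup.mul_mem_cancel_left _ htK, inv_mem_iff] at hx₃K'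
  · push Not at hall
    obtain ⟨u, hu⟩ := hall
    have huA : u ∉ A := fun h ↦ hu (by rw [S.apply_mul _ _ h, S.apply_mul _ _ h, hx₂, hx₃'])
    have hugA : g⁻¹ * u ∉ A := fun h ↦ hu (by
      obtain ⟨v, hv, rfl⟩ : ∃ v ∈ A, u = g * v := ⟨_, h, by group⟩
      rw [← mul_assoc, ← mul_assoc, S.apply_mul _ _ hv, S.apply_mul _ _ hv, hx₂g, hx₃])
    have hb : σ (x₂ * u) = !σ (x₃ * u) := Bool.eq_not_of_ne hu
    obtain ⟨h1, h2⟩ := hg u a (σ (x₃ * u)) c x₁ x₂ x₃ x₄ hx₁ (by rw [hx u huA, hb]) hx₁g hx₂ hb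
      hx₂g hx₃' rfl hx₃ hx₄' (hx' u hugA).symm hx₄
    simpa using mul_mem (ih _ h1 u rfl) (ih _ h2 _ rfl)

theorem apply_list_prod (S : IsEdgeSide A t σ) {H : Type*} [Group H] {j : H →* G}
    (hj : j.range = vertexStabilizer σ) {A' B' : Subgroup H} (hA' : A' = A.comap j)
    (hB' : B' = (A.map (MulAut.conj t).toMonoidHom).comap j) (p : ℤˣ × H) (l : List (ℤˣ × H))
    (hl : (p :: l).IsChain fun a b ↦ a.2 ∈ HNNExtension.toSubgroup A' B' a.1 → a.1 = b.1) :
    (p.1 = 1 → σ ((((p :: l).map fun x ↦ t ^ (x.1 : ℤ) * j x.2).prod)⁻¹ * t) = true) ∧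
      (p.1 = -1 → σ (((p :: l).map fun x ↦ t ^ (x.1 : ℤ) * j x.2).prod)⁻¹ = false) := by
  have hjmem : ∀ h, (j h)⁻¹ ∈ vertexStabilizer σ := fun h ↦ hj ▸ inv_mem ⟨h, rfl⟩
  have hjσ : ∀ h, σ (j h)⁻¹ = true := fun h ↦ S.apply_vertex (hjmem h)
  have hjt : ∀ h, σ ((j h)⁻¹ * t) = false := fun h ↦ by rw [hjmem h, S.stable]
  have ht : ∀ h, t⁻¹ * (j h)⁻¹ ∉ A := fun h hmem ↦ by
    have := S.apply_mul t _ hmem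
    rw [mul_inv_cancel_left, hjσ, S.stable] at this
    simp at this
  have ht' : ∀ h, (j h)⁻¹ * t ∉ A := fun h hmem ↦ by
    have := S.apply_of_mem hmem
    rw [hjt] at this
    simp at this
  induction l generalizing p with
  | nil =>
    obtain ⟨u, h⟩ := p
    constructor <;> rintro rfl
    · simpa [mul_assoc] using hjσ h
    · simpa [mul_assoc] using hjt h
  | cons q l ih =>
    obtain ⟨u, h⟩ := p
    rw [List.isChain_cons_cons] at hl
    obtain ⟨ih1, ih2⟩ := ih q hl.2
    have hl1 := hl.1
    rw [List.map_cons, List.prod_cons]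
    generalize ((q :: l).map fun x ↦ t ^ (x.1 : ℤ) * j x.2).prod = w at ih1 ih2 ⊢
    obtain ⟨v, k⟩ := q
    simp only at ih1 ih2 hl1
    constructor <;> rintro rfl
    · suffices σ (w⁻¹ * (j h)⁻¹) = σ (j h)⁻¹ by simpa [mul_assoc, hjσ] using this
      have hinc : IsIncident A σ (j h)⁻¹ := by
        simpa using S.isIncident_one.mul_left (hjmem h)
      rcases Int.units_eq_one_or v with rfl | rfl
      · exact S.far_sides_disjoint S.isIncident_stable hinc (ht h) (by simp [ih1 rfl, S.stable])
      · refine S.far_sides_disjoint S.isIncident_one hinc ?_ (by simp [ih2 rfl, S.one])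
        intro hmem
        have : h ∈ A' := by simpa [hA'] using hmem
        simpa using hl1 (by simpa using this)
    · suffices σ (w⁻¹ * ((j h)⁻¹ * t)) = σ ((j h)⁻¹ * t) by simpa [mul_assoc, hjt] using this
      have hinc : IsIncident A σ ((j h)⁻¹ * t) := S.isIncident_stable.mul_left (hjmem h)
      rcases Int.units_eq_one_or v with rfl | rfl
      · refine S.far_sides_disjoint S.isIncident_stable hinc ?_ (by simp [ih1 rfl, S.stable])
        intro hmem
        have : h ∈ B' := by
          rw [hB']
          refine ⟨_, inv_mem hmem, ?_⟩
          simp [mul_assoc]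
        have := hl1 (by simpa using this)
        exact absurd this (by decide)
      · exact S.far_sides_disjoint S.isIncident_one hinc (by simpa using ht' h)
          (by simp [ih2 rfl, S.one])

/-- A group acting on a tree with one orbit of vertices and one orbit of edges is an HNN
extension of a vertex stabilizer. -/
theorem exists_hnnExtension (S : IsEdgeSide A t σ)
    (hgen : ∀ g, g ∈ Subgroup.closure (insert t (vertexStabilizer σ : Set G)))
    {H : Type*} [Group H] (e : H ≃* vertexStabilizer σ) :
    ∃ (A' B' : Subgroup H) (φ : A' ≃* B'),
      Nonempty (A' ≃* A) ∧ Nonempty (G ≃* HNNExtension H A' B' φ) := by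
  set j : H →* G := (vertexStabilizer σ).subtype.comp e.toMonoidHom with hjdef
  have hjinj : Function.Injective j := Subtype.val_injective.comp e.injective
  have hj : j.range = vertexStabilizer σ := by
    ext x
    constructor
    · rintro ⟨y, rfl⟩
      exact (e y).2
    · intro hx
      exact ⟨e.symm ⟨x, hx⟩, by simp [hjdef]⟩
  have hcomap : ∀ C : Subgroup G, C ≤ vertexStabilizer σ →
      Function.Bijective (j.subgroupComap C) := by
    intro C hC
    constructor
    · intro x y hxy
      have hxy' : j x = j y := by simpa only [Subtype.ext_iff] using! hxy
      exact Subtype.ext (hjinj hxy')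
    · rintro ⟨x, hx⟩
      obtain ⟨y, rfl⟩ : x ∈ j.range := hj ▸ hC hx
      exact ⟨⟨y, hx⟩, rfl⟩
  have hB : A.map (MulAut.conj t).toMonoidHom ≤ vertexStabilizer σ := by
    rintro _ ⟨a, ha, rfl⟩
    exact S.conj_mem_vertexStabilizer ha
  let eA := MulEquiv.ofBijective _ (hcomap A S.le_vertexStabilizer)
  let eB := MulEquiv.ofBijective _ (hcomap _ hB)
  let φ := (eA.trans (A.equivMapOfInjective (MulAut.conj t).toMonoidHom
    (MulAut.conj t).injective)).trans eB.symm
  have hφ : ∀ a, j (φ a) = t * j a * t⁻¹ := fun a ↦ by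
    have : eB (φ a) = _ := eB.apply_symm_apply _
    exact congrArg Subtype.val this
  refine ⟨A.comap j, (A.map (MulAut.conj t).toMonoidHom).comap j, φ, ⟨eA⟩, ?_⟩
  let L : HNNExtension H _ _ φ →* G := HNNExtension.lift j t fun a ↦ by rw [hφ]; group
  have hLt : L HNNExtension.t = t := HNNExtension.lift_t _ _ _
  have hLof : ∀ y, L (HNNExtension.of y) = j y := fun y ↦ HNNExtension.lift_of _ _ _ _
  have hLsurj : Function.Surjective L := by
    rw [← MonoidHom.range_eq_top, eq_top_iff]
    rintro g -
    have hle : Subgroup.closure (insert t (vertexStabilizer σ : Set G)) ≤ L.range := by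
      rw [Subgroup.closure_le, Set.insert_subset_iff]
      refine ⟨⟨HNNExtension.t, hLt⟩, fun x hx ↦ ?_⟩
      obtain ⟨y, rfl⟩ : x ∈ j.range := hj ▸ hx
      exact ⟨HNNExtension.of y, hLof y⟩
    exact hle (hgen g)
  have hLinj : Function.Injective L := by
    rw [injective_iff_map_eq_one]
    intro x hx
    obtain ⟨T⟩ := HNNExtension.NormalWord.TransversalPair.nonempty H (A.comap j)
      ((A.map (MulAut.conj t).toMonoidHom).comap j)
    obtain ⟨⟨⟨h, l, hl⟩, hmem⟩, rfl⟩ := (HNNExtension.NormalWord.equiv φ T).symm.surjective x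
    have hprod : L ((HNNExtension.NormalWord.equiv φ T).symm ⟨⟨h, l, hl⟩, hmem⟩) =
        j h * (l.map fun x ↦ t ^ (x.1 : ℤ) * j x.2).prod := by
      simp only [HNNExtension.NormalWord.equiv, Equiv.coe_fn_symm_mk,
        HNNExtension.NormalWord.ReducedWord.prod, map_mul, map_list_prod, List.map_map]
      rw [hLof]
      congr 2
      refine List.map_congr_left fun x _ ↦ ?_
      exact (L.map_mul _ _).trans (by rw [L.map_zpow, hLt, hLof])
    rw [hprod] at hx
    cases l with
    | nil =>
      have : h = 1 := hjinj (by simpa using hx)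
      subst this
      change HNNExtension.of 1 * 1 = 1
      rw [map_one, mul_one]
    | cons p l =>
      exfalso
      obtain ⟨h1, h2⟩ := S.apply_list_prod hj rfl rfl p l hl
      rw [inv_eq_of_mul_eq_one_left hx] at h1 h2
      have hjh : j h ∈ vertexStabilizer σ := hj ▸ ⟨h, rfl⟩
      rcases Int.units_eq_one_or p.1 with hp | hp
      · have := h1 hp
        rw [hjh, S.stable] at this
        simp at this
      · have := h2 hp
        rw [S.apply_vertex hjh] at this
        simp at this
  exact ⟨(MulEquiv.ofBijective L ⟨hLinj, hLsurj⟩).symm⟩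

end IsEdgeSide

/-- The Lorentzian bilinear form `M₂ N₂ + M₃ N₃ - 2 (M₀ N₁ + M₁ N₀)` on `ℝ⁴`. -/
def mink (M N : Fin 4 → ℝ) : ℝ := M 2 * N 2 + M 3 * N 3 - 2 * (M 0 * N 1 + M 1 * N 0)

/-- Future-directed causal vectors for `mink`. -/
structure IsForward (M : Fin 4 → ℝ) : Prop where
  nonneg_zero : 0 ≤ M 0
  nonneg_one : 0 ≤ M 1
  causal : mink M M ≤ 0

theorem mink_comm (M N : Fin 4 → ℝ) : mink M N = mink N M := by
  simp only [mink]
  ring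

theorem mink_add_right (M N N' : Fin 4 → ℝ) : mink M (N + N') = mink M N + mink M N' := by
  simp only [mink, Pi.add_apply]
  ring

theorem mink_smul_right (c : ℝ) (M N : Fin 4 → ℝ) : mink M (c • N) = c * mink M N := by
  simp only [mink, Pi.smul_apply, smul_eq_mul]
  ring

theorem mink_neg_right (M N : Fin 4 → ℝ) : mink M (-N) = -mink M N := by
  simp only [mink, Pi.neg_apply]
  ring

theorem mink_sub_right (M N N' : Fin 4 → ℝ) : mink M (N - N') = mink M N - mink M N' := by
  rw [sub_eq_add_neg, mink_add_right, mink_neg_right, sub_eq_add_neg]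

theorem mink_add_left (M M' N : Fin 4 → ℝ) : mink (M + M') N = mink M N + mink M' N := by
  simp only [mink_comm _ N, mink_add_right]

theorem mink_sub_left (M M' N : Fin 4 → ℝ) : mink (M - M') N = mink M N - mink M' N := by
  simp only [mink_comm _ N, mink_sub_right]

theorem mink_smul_left (c : ℝ) (M N : Fin 4 → ℝ) : mink (c • M) N = c * mink M N := by
  simp only [mink_comm _ N, mink_smul_right]

theorem four_mul_sq_sub_mink {M N : Fin 4 → ℝ} (hN : IsForward N) :
    4 * (M 0 * N 1 - M 1 * N 0) ^ 2 + 4 * (N 0 * N 1) * (-mink M M) ≤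
      4 * (M 0 * N 1 + M 1 * N 0) ^ 2 - (M 2 * N 2 + M 3 * N 3) ^ 2 := by
  have hN' := hN.causal
  have h := mul_nonneg (add_nonneg (sq_nonneg (M 2)) (sq_nonneg (M 3))) (neg_nonneg.2 hN')
  simp only [mink] at *
  nlinarith [sq_nonneg (M 2 * N 3 - M 3 * N 2)]

theorem IsForward.mink_nonpos {M N : Fin 4 → ℝ} (hM : IsForward M) (hN : IsForward N) :
    mink M N ≤ 0 := by
  have h := four_mul_sq_sub_mink (M := M) hN
  have h1 := mul_nonneg (mul_nonneg hN.nonneg_zero hN.nonneg_one) (neg_nonneg.2 hM.causal)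
  have h2 : 0 ≤ M 0 * N 1 + M 1 * N 0 := add_nonneg (mul_nonneg hM.nonneg_zero hN.nonneg_one)
    (mul_nonneg hM.nonneg_one hN.nonneg_zero)
  have h3 := abs_le_of_sq_le_sq (a := M 2 * N 2 + M 3 * N 3) (b := 2 * (M 0 * N 1 + M 1 * N 0))
    (by nlinarith [sq_nonneg (M 0 * N 1 - M 1 * N 0)]) (by linarith)
  simp only [mink]
  linarith [le_abs_self (M 2 * N 2 + M 3 * N 3)]

theorem IsForward.mink_neg {M N : Fin 4 → ℝ} (hM : IsForward M) (hM' : mink M M < 0)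
    (hN : IsForward N) (hN' : 0 < N 0 + N 1) : mink M N < 0 := by
  have h := four_mul_sq_sub_mink (M := M) hN
  have h0 : 0 < M 0 * M 1 := by
    simp only [mink] at hM'
    nlinarith [sq_nonneg (M 2), sq_nonneg (M 3)]
  have hM0 : 0 < M 0 := pos_of_mul_pos_left h0 hM.nonneg_one
  have hM1 : 0 < M 1 := pos_of_mul_pos_right h0 hM.nonneg_zero
  have hN0 := hN.nonneg_zero
  have hN1 := hN.nonneg_one
  have h1 : 0 < 4 * (M 0 * N 1 - M 1 * N 0) ^ 2 + 4 * (N 0 * N 1) * (-mink M M) := by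
    rcases hN0.eq_or_lt with h0 | h0
    · rw [← h0] at hN' ⊢
      have : 0 < M 0 * N 1 := by nlinarith
      nlinarith
    rcases hN1.eq_or_lt with h1 | h1
    · rw [← h1]
      have : 0 < M 1 * N 0 := by nlinarith
      nlinarith
    have := mul_pos (mul_pos h0 h1) (neg_pos.2 hM')
    nlinarith [sq_nonneg (M 0 * N 1 - M 1 * N 0)]
  have h2 : 0 ≤ M 0 * N 1 + M 1 * N 0 := by positivity
  have h3 := abs_lt_of_sq_lt_sq (a := M 2 * N 2 + M 3 * N 3) (b := 2 * (M 0 * N 1 + M 1 * N 0))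
    (by nlinarith) (by linarith)
  simp only [mink]
  linarith [le_abs_self (M 2 * N 2 + M 3 * N 3)]

theorem isForward_or_isForward_neg {M : Fin 4 → ℝ} (hM : mink M M ≤ 0) :
    IsForward M ∨ IsForward (-M) := by
  have h : 0 ≤ M 0 * M 1 := by
    simp only [mink] at hM
    nlinarith [sq_nonneg (M 2), sq_nonneg (M 3)]
  have hM' : mink (-M) (-M) ≤ 0 := by
    rwa [mink_neg_right, mink_comm, mink_neg_right, neg_neg]
  rcases mul_nonneg_iff.1 h with h | h
  · exact Or.inl ⟨h.1, h.2, hM⟩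
  · exact Or.inr ⟨neg_nonneg.2 h.1, neg_nonneg.2 h.2, hM'⟩

theorem isForward_of_mink_neg {M X : Fin 4 → ℝ} (hX : IsForward X) (hM : mink M M ≤ 0)
    (h : mink X M < 0) : IsForward M ∧ 0 < M 0 + M 1 := by
  rcases isForward_or_isForward_neg hM with h' | h'
  · refine ⟨h', (add_nonneg h'.nonneg_zero h'.nonneg_one).lt_of_ne fun h0 ↦ ?_⟩
    have h00 : M 0 = 0 := by linarith [h'.nonneg_zero, h'.nonneg_one]
    have h01 : M 1 = 0 := by linarith [h'.nonneg_zero, h'.nonneg_one]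
    simp only [mink, h00, h01] at h hM
    have h2 : M 2 = 0 := by nlinarith [sq_nonneg (M 2), sq_nonneg (M 3)]
    have h3 : M 3 = 0 := by nlinarith [sq_nonneg (M 2), sq_nonneg (M 3)]
    simp [h2, h3] at h
  · have := hX.mink_nonpos h'
    rw [mink_neg_right] at this
    linarith

/-- Two unit spacelike vectors whose half-spaces intersect, and whose complementary half-spaces
intersect, do not have product `≤ -1`. -/
theorem neg_one_lt_mink {v u X Y : Fin 4 → ℝ} (hv : mink v v = 1) (hu : mink u u = 1)
    (hX : IsForward X) (hY : IsForward Y) (hXv : 0 < mink X v) (hXu : 0 < mink X u)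
    (hYv : mink Y v < 0) (hYu : mink Y u < 0) : -1 < mink v u := by
  by_contra! h
  have hM : mink (v + u) (v + u) ≤ 0 := by
    simp only [mink_add_left, mink_add_right, mink_comm u v]
    linarith
  have h1 := (isForward_of_mink_neg hY hM (by rw [mink_add_right]; linarith)).1
  have h2 := hX.mink_nonpos h1
  rw [mink_add_right] at h2
  linarith

/-- If the half-space of `u` is strictly between those of `v` and `w`, then the hyperplane of `u`
is closer to those of `v` and `w` than these are to each other. -/
theorem abs_mink_lt_of_between {v u w X₁ X₂ X₃ X₄ : Fin 4 → ℝ} (hv : mink v v = 1)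
    (hu : mink u u = 1) (hw : mink w w = 1) (hvu : 1 ≤ |mink v u|) (huw : 1 ≤ |mink u w|)
    (hvw : |mink v w| ≠ 1) (hX₁ : IsForward X₁) (hX₂ : IsForward X₂) (hX₃ : IsForward X₃)
    (hX₄ : IsForward X₄) (h1v : 0 < mink X₁ v) (h1u : 0 < mink X₁ u) (h1w : 0 < mink X₁ w)
    (h2v : mink X₂ v < 0) (h2u : 0 < mink X₂ u) (h3u : mink X₃ u < 0) (h3w : 0 < mink X₃ w)
    (h4v : mink X₄ v < 0) (h4u : mink X₄ u < 0) (h4w : mink X₄ w < 0) :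
    |mink v u| < |mink v w| ∧ |mink u w| < |mink v w| := by
  have hα : 1 ≤ mink v u := by
    have := neg_one_lt_mink hv hu hX₁ hX₄ h1v h1u h4v h4u
    exact (le_abs.1 hvu).resolve_right (by linarith)
  have hβ : 1 ≤ mink u w := by
    have := neg_one_lt_mink hu hw hX₁ hX₄ h1u h1w h4u h4w
    exact (le_abs.1 huw).resolve_right (by linarith)
  have hM : mink (v - u) (v - u) = 2 - 2 * mink v u := by
    simp only [mink_sub_left, mink_sub_right, mink_comm u v]
    linarith
  have hM' : mink (u - w) (u - w) = 2 - 2 * mink u w := by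
    simp only [mink_sub_left, mink_sub_right, mink_comm w u]
    linarith
  obtain ⟨hF, hF0⟩ := isForward_of_mink_neg hX₂ (M := v - u) (by linarith)
    (by rw [mink_sub_right]; linarith)
  obtain ⟨hF', hF0'⟩ := isForward_of_mink_neg hX₃ (M := u - w) (by linarith)
    (by rw [mink_sub_right]; linarith)
  have hMM' : mink (v - u) (u - w) = mink v u - mink v w - 1 + mink u w := by
    simp only [mink_sub_left, mink_sub_right]
    linarith
  have hle := hF.mink_nonpos hF'
  have hγ : 1 < mink v w := by
    refine lt_of_le_of_ne (by linarith) fun h ↦ hvw ?_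
    rw [← h, abs_one]
  rw [abs_of_pos (by linarith : 0 < mink v u), abs_of_pos (by linarith : 0 < mink u w),
    abs_of_pos (by linarith : 0 < mink v w)]
  constructor
  · rcases hα.eq_or_lt with h | h
    · linarith
    · linarith [hF.mink_neg (by linarith) hF' hF0']
  · rcases hβ.eq_or_lt with h | h
    · linarith
    · have := hF'.mink_neg (by linarith) hF hF0
      rw [mink_comm] at this
      linarith

open ComplexConjugate

/-- The hyperbolic plane in hyperbolic space spanned by the image under `y` of the real line,
as a unit spacelike vector. -/
noncomputable def planeVector (y : SL2 ℂ) : Fin 4 → ℝ :=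
  ![(y 0 0 * conj (y 0 1)).im, (y 1 0 * conj (y 1 1)).im,
    (y 0 0 * conj (y 1 1) - y 0 1 * conj (y 1 0)).re,
    (y 0 0 * conj (y 1 1) - y 0 1 * conj (y 1 0)).im]

/-- The image under `x⁻¹` of the point of hyperbolic space at height one above `z`, as a timelike
vector. -/
noncomputable def pointVector (z : ℂ) (x : SL2 ℂ) : Fin 4 → ℝ :=
  ![(Complex.normSq (x 0 1 - z * x 1 1) + Complex.normSq (x 1 1)) / 2,
    (Complex.normSq (x 0 0 - z * x 1 0) + Complex.normSq (x 1 0)) / 2,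
    (conj (x 0 0 - z * x 1 0) * (x 0 1 - z * x 1 1) + conj (x 1 0) * x 1 1).im,
    -(conj (x 0 0 - z * x 1 0) * (x 0 1 - z * x 1 1) + conj (x 1 0) * x 1 1).re]

/-- The signed distance (up to a monotone reparametrization) of the point at height one above `z`
to the plane of `y`. -/
noncomputable def planeSide (z : ℂ) (y : SL2 ℂ) : ℝ :=
  planeVector y 0 + (Complex.normSq z + 1) * planeVector y 1 + z.im * planeVector y 2
    - z.re * planeVector y 3

theorem det_re (y : SL2 ℂ) : (y 0 0).re * (y 1 1).re - (y 0 0).im * (y 1 1).im -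
    ((y 0 1).re * (y 1 0).re - (y 0 1).im * (y 1 0).im) = 1 := by
  have h := congrArg Complex.re y.det_coe
  rw [Matrix.det_fin_two] at h
  simpa using h

theorem det_im (y : SL2 ℂ) : (y 0 0).re * (y 1 1).im + (y 0 0).im * (y 1 1).re -
    ((y 0 1).re * (y 1 0).im + (y 0 1).im * (y 1 0).re) = 0 := by
  have h := congrArg Complex.im y.det_coe
  rw [Matrix.det_fin_two] at h
  simpa using h

theorem SL2_mul_apply {R : Type*} [CommRing R] (x y : SL2 R) (i j : Fin 2) :
    (x * y) i j = x i 0 * y 0 j + x i 1 * y 1 j := by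
  simp [Matrix.mul_apply, Fin.sum_univ_two]

theorem SL2_map_apply {R S : Type*} [CommRing R] [CommRing S] (f : R →+* S) (y : SL2 R)
    (i j : Fin 2) : (y.map f) i j = f (y i j) := rfl

theorem mink_planeVector_self (y : SL2 ℂ) : mink (planeVector y) (planeVector y) = 1 := by
  have h1 := det_re y
  have h2 := det_im y
  simp [mink, planeVector]
  linear_combination (((y 0 0).re * (y 1 1).re - (y 0 0).im * (y 1 1).im -
    ((y 0 1).re * (y 1 0).re - (y 0 1).im * (y 1 0).im)) + 1) * h1 +
    ((y 0 0).re * (y 1 1).im + (y 0 0).im * (y 1 1).re -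
    ((y 0 1).re * (y 1 0).im + (y 0 1).im * (y 1 0).re)) * h2

theorem mink_planeVector (u g : SL2 ℂ) :
    mink (planeVector u) (planeVector g) = planeVector (u⁻¹ * g) 2 := by
  have h00 : (u⁻¹) 0 0 = u 1 1 := by simp [Matrix.SpecialLinearGroup.SL2_inv_expl]
  have h01 : (u⁻¹) 0 1 = -u 0 1 := by simp [Matrix.SpecialLinearGroup.SL2_inv_expl]
  have h10 : (u⁻¹) 1 0 = -u 1 0 := by simp [Matrix.SpecialLinearGroup.SL2_inv_expl]
  have h11 : (u⁻¹) 1 1 = u 0 0 := by simp [Matrix.SpecialLinearGroup.SL2_inv_expl]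
  simp only [planeVector, SL2_mul_apply, h00, h01, h10, h11]
  simp [mink]
  ring

theorem planeVector_two (y : SL2 ℂ) :
    planeVector y 2 = 1 + 2 * ((y 0 0).im * (y 1 1).im - (y 0 1).im * (y 1 0).im) := by
  have h1 := det_re y
  simp [planeVector]
  linear_combination h1

theorem isForward_pointVector (z : ℂ) (x : SL2 ℂ) : IsForward (pointVector z x) := by
  have h1 := det_re x
  have h2 := det_im x
  refine ⟨?_, ?_, ?_⟩
  · simp only [pointVector, Matrix.cons_val]
    have := Complex.normSq_nonneg (x 0 1 - z * x 1 1)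
    have := Complex.normSq_nonneg (x 1 1)
    linarith
  · simp only [pointVector, Matrix.cons_val]
    have := Complex.normSq_nonneg (x 0 0 - z * x 1 0)
    have := Complex.normSq_nonneg (x 1 0)
    linarith
  · have : mink (pointVector z x) (pointVector z x) = -1 := by
      simp [mink, pointVector, Complex.normSq_apply]
      linear_combination -(((x 0 0).re * (x 1 1).re - (x 0 0).im * (x 1 1).im -
        ((x 0 1).re * (x 1 0).re - (x 0 1).im * (x 1 0).im)) + 1) * h1 -
        ((x 0 0).re * (x 1 1).im + (x 0 0).im * (x 1 1).re -
        ((x 0 1).re * (x 1 0).im + (x 0 1).im * (x 1 0).re)) * h2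
    linarith

theorem planeSide_mul (z : ℂ) (x g : SL2 ℂ) :
    planeSide z (x * g) = -mink (pointVector z x) (planeVector g) := by
  simp [mink, planeSide, pointVector, planeVector, Matrix.mul_apply, Fin.sum_univ_two,
    Complex.normSq_apply]
  ring

theorem planeVector_neg (y : SL2 ℂ) : planeVector (-y) = planeVector y := by
  simp [planeVector]

theorem planeVector_mul_intCast (y : SL2 ℂ) (a : SL2 ℤ) :
    planeVector (y * a.map (Int.castRingHom ℂ)) = planeVector y := by
  have h : (a 0 0 * a 1 1 - a 0 1 * a 1 0 : ℝ) = 1 := by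
    exact_mod_cast (Matrix.det_fin_two _).symm.trans a.det_coe
  ext i
  fin_cases i
  all_goals simp [planeVector, Matrix.mul_apply, Fin.sum_univ_two]
  · linear_combination ((y 0 0).im * (y 0 1).re - (y 0 0).re * (y 0 1).im) * h
  · linear_combination ((y 1 0).im * (y 1 1).re - (y 1 0).re * (y 1 1).im) * h
  · linear_combination ((y 0 0).re * (y 1 1).re + (y 0 0).im * (y 1 1).im -
      ((y 0 1).re * (y 1 0).re + (y 0 1).im * (y 1 0).im)) * h
  · linear_combination ((y 0 0).im * (y 1 1).re - (y 0 0).re * (y 1 1).im -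
      ((y 0 1).im * (y 1 0).re - (y 0 1).re * (y 1 0).im)) * h

/-- The upper unitriangular matrix with off-diagonal entry `x`. -/
def unipotent {R : Type*} [CommRing R] (x : R) : SL2 R := ⟨!![1, x; 0, 1], by simp⟩

theorem unipotent_mul {R : Type*} [CommRing R] (x y : R) :
    unipotent x * unipotent y = unipotent (x + y) := by
  ext i j
  rw [SL2_mul_apply]
  fin_cases i <;> fin_cases j <;> simp [unipotent, add_comm]

theorem unipotent_zero {R : Type*} [CommRing R] : unipotent (0 : R) = 1 := by
  ext i j
  fin_cases i <;> fin_cases j <;> simp [unipotent]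

theorem unipotent_zpow {R : Type*} [CommRing R] (x : R) (k : ℤ) :
    unipotent x ^ k = unipotent (k * x) := by
  have hinv : (unipotent x)⁻¹ = unipotent (-x) := by
    rw [inv_eq_iff_mul_eq_one, unipotent_mul, add_neg_cancel, unipotent_zero]
  induction k using Int.induction_on with
  | zero => simp [unipotent_zero]
  | succ i ih => rw [zpow_add_one, ih, unipotent_mul]; congr 1; push_cast; ring
  | pred i ih => rw [zpow_sub_one, ih, hinv, unipotent_mul]; congr 1; push_cast; ring

/-- An embedding `ι` of a ring with `ℤ`-basis `1, ω` in `ℂ`, as an order in an imaginary quadratic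
field with no units besides `±1`. -/
structure IsImaginaryQuadratic {R : Type*} [CommRing R] (ι : R →+* ℂ) (ω : R) : Prop where
  injective : Function.Injective ι
  exists_eq : ∀ x, ∃ m n : ℤ, x = m + n * ω
  one_lt_im : 1 < (ι ω).im
  exists_four_mul_sq : ∃ D : ℤ, 4 * (ι ω).im ^ 2 = D

namespace IsImaginaryQuadratic

variable {R : Type*} [CommRing R] {ι : R →+* ℂ} {ω : R}

theorem exists_re_im (hι : IsImaginaryQuadratic ι ω) (x : R) :
    ∃ m n : ℤ, (ι x).re = m + n * (ι ω).re ∧ (ι x).im = n * (ι ω).im := by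
  obtain ⟨m, n, rfl⟩ := hι.exists_eq x
  exact ⟨m, n, by simp, by simp⟩

theorem exists_im_mul_conj (hι : IsImaginaryQuadratic ι ω) (x y : R) :
    ∃ n : ℤ, (ι x * conj (ι y)).im = n * (ι ω).im := by
  obtain ⟨m, n, h1, h2⟩ := hι.exists_re_im x
  obtain ⟨m', n', h1', h2'⟩ := hι.exists_re_im y
  refine ⟨n * m' - m * n', ?_⟩
  simp [h1, h2, h1', h2']
  ring

theorem exists_planeVector_zero (hι : IsImaginaryQuadratic ι ω) (y : SL2 R) :
    ∃ n : ℤ, planeVector (y.map ι) 0 = n * (ι ω).im :=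
  hι.exists_im_mul_conj (y 0 0) (y 0 1)

theorem exists_planeVector_one (hι : IsImaginaryQuadratic ι ω) (y : SL2 R) :
    ∃ n : ℤ, planeVector (y.map ι) 1 = n * (ι ω).im :=
  hι.exists_im_mul_conj (y 1 0) (y 1 1)

theorem exists_planeVector_three (hι : IsImaginaryQuadratic ι ω) (y : SL2 R) :
    ∃ n : ℤ, planeVector (y.map ι) 3 = n * (ι ω).im := by
  obtain ⟨n, hn⟩ := hι.exists_im_mul_conj (y 0 0) (y 1 1)
  obtain ⟨n', hn'⟩ := hι.exists_im_mul_conj (y 0 1) (y 1 0)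
  refine ⟨n - n', ?_⟩
  change (ι (y 0 0) * conj (ι (y 1 1)) - ι (y 0 1) * conj (ι (y 1 0))).im = _
  rw [Complex.sub_im, hn, hn']
  push_cast
  ring

theorem exists_planeVector_two (hι : IsImaginaryQuadratic ι ω) (y : SL2 R) :
    ∃ n : ℤ, planeVector (y.map ι) 2 = 1 + 2 * (ι ω).im ^ 2 * n := by
  obtain ⟨_, p, -, hp⟩ := hι.exists_re_im (y 0 0)
  obtain ⟨_, q, -, hq⟩ := hι.exists_re_im (y 0 1)
  obtain ⟨_, r, -, hr⟩ := hι.exists_re_im (y 1 0)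
  obtain ⟨_, s, -, hs⟩ := hι.exists_re_im (y 1 1)
  refine ⟨p * s - q * r, ?_⟩
  rw [planeVector_two]
  change 1 + 2 * ((ι (y 0 0)).im * (ι (y 1 1)).im - (ι (y 0 1)).im * (ι (y 1 0)).im) = _
  rw [hp, hq, hr, hs]
  push_cast
  ring

theorem exists_two_mul_planeVector_two (hι : IsImaginaryQuadratic ι ω) (y : SL2 R) :
    ∃ n : ℤ, 2 * planeVector (y.map ι) 2 = n := by
  obtain ⟨n, hn⟩ := hι.exists_planeVector_two y
  obtain ⟨D, hD⟩ := hι.exists_four_mul_sq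
  exact ⟨2 + D * n, by push_cast; rw [hn, ← hD]; ring⟩

theorem one_le_or_lt_neg_one (hι : IsImaginaryQuadratic ι ω) (y : SL2 R) :
    1 ≤ planeVector (y.map ι) 2 ∨ planeVector (y.map ι) 2 < -1 := by
  obtain ⟨n, hn⟩ := hι.exists_planeVector_two y
  have h1 := hι.one_lt_im
  rw [hn]
  rcases lt_or_ge n 0 with h | h
  · right
    have : (n : ℝ) ≤ -1 := by exact_mod_cast (by omega : n ≤ -1)
    nlinarith
  · left
    have : (0 : ℝ) ≤ n := by exact_mod_cast h
    have : 0 ≤ 2 * (ι ω).im ^ 2 * n := by positivity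
    linarith

/-- A plane whose boundary does not contain `∞` lies below height one. -/
theorem planeVector_mul_planeSide_pos (hι : IsImaginaryQuadratic ι ω) (z : ℂ) {y : SL2 R}
    (h : planeVector (y.map ι) 1 ≠ 0) :
    0 < planeVector (y.map ι) 1 * planeSide z (y.map ι) := by
  have h1 : 1 < planeVector (y.map ι) 1 ^ 2 := by
    obtain ⟨n, hn⟩ := hι.exists_planeVector_one y
    have hδ := hι.one_lt_im
    have hn0 : n ≠ 0 := by
      rintro rfl
      simp [hn] at h
    have : (1 : ℝ) ≤ n ^ 2 := by
      have : 0 < n ^ 2 := by positivity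
      exact_mod_cast this
    rw [hn, mul_pow]
    nlinarith
  have h2 := mink_planeVector_self (y.map ι)
  rw [mink] at h2
  rw [planeSide, Complex.normSq_apply]
  generalize planeVector (y.map ι) = V at *
  nlinarith [sq_nonneg (V 2 / 2 + V 1 * z.im), sq_nonneg (V 3 / 2 - V 1 * z.re)]

/-- A plane whose boundary contains `∞` is a translate of the standard one. -/
theorem exists_eq_unipotent_mul (hι : IsImaginaryQuadratic ι ω) {y : SL2 R}
    (h : planeVector (y.map ι) 1 = 0) :
    ∃ (k : ℤ) (a : SL2 ℤ), y = unipotent (k * ω) * a.map (Int.castRingHom R) := by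
  have hω : (ι ω).im ≠ 0 := by linarith [hι.one_lt_im]
  have hV := mink_planeVector_self (y.map ι)
  rw [mink, h] at hV
  have hV2 : planeVector (y.map ι) 2 = 1 := by
    rcases hι.one_le_or_lt_neg_one y with h' | h'
    · nlinarith [sq_nonneg (planeVector (y.map ι) 3)]
    · nlinarith [sq_nonneg (planeVector (y.map ι) 3)]
  have hV3 : planeVector (y.map ι) 3 = 0 := by
    rw [hV2] at hV
    nlinarith
  have hdet : y 0 0 * y 1 1 - y 0 1 * y 1 0 = 1 := (Matrix.det_fin_two _).symm.trans y.det_coe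
  have hw : ι (y 0 0) * conj (ι (y 1 1)) - ι (y 0 1) * conj (ι (y 1 0)) = 1 :=
    Complex.ext hV2 hV3
  have hdet' : ι (y 0 0) * ι (y 1 1) - ι (y 0 1) * ι (y 1 0) = 1 := by
    simpa using congrArg ι hdet
  have hP : ι (y 1 0) * conj (ι (y 1 1)) = conj (ι (y 1 0)) * ι (y 1 1) := by
    have : conj (ι (y 1 0) * conj (ι (y 1 1))) = ι (y 1 0) * conj (ι (y 1 1)) :=
      Complex.conj_eq_iff_im.2 h
    simpa using this.symm
  have hr : conj (ι (y 1 0)) = ι (y 1 0) := by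
    linear_combination ι (y 1 0) * hw - conj (ι (y 1 0)) * hdet' - ι (y 0 0) * hP
  have hs : conj (ι (y 1 1)) = ι (y 1 1) := by
    linear_combination ι (y 1 1) * hw - conj (ι (y 1 1)) * hdet' - ι (y 0 1) * hP
  have hint : ∀ x : R, conj (ι x) = ι x → ∃ m : ℤ, x = m := by
    intro x hx
    obtain ⟨m, n, rfl⟩ := hι.exists_eq x
    have : n = 0 := by simpa [hω] using Complex.conj_eq_iff_im.1 hx
    exact ⟨m, by simp [this]⟩
  obtain ⟨r, hr⟩ := hint _ hr
  obtain ⟨s, hs⟩ := hint _ hs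
  obtain ⟨p₁, p₂, hp⟩ := hι.exists_eq (y 0 0)
  obtain ⟨q₁, q₂, hq⟩ := hι.exists_eq (y 0 1)
  have hind : ∀ m n : ℤ, (m + n * ω : R) = 1 → m = 1 ∧ n = 0 := by
    intro m n hmn
    have hmn := congrArg ι hmn
    have hn : n = 0 := by simpa [hω] using congrArg Complex.im hmn
    subst hn
    exact ⟨by simpa using hmn, rfl⟩
  obtain ⟨h1, h2⟩ := hind (p₁ * s - q₁ * r) (p₂ * s - q₂ * r) (by
    rw [hp, hq, hr, hs] at hdet
    push_cast
    linear_combination hdet)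
  refine ⟨p₁ * q₂ - q₁ * p₂, ⟨!![p₁, q₁; r, s], by simpa [Matrix.det_fin_two] using h1⟩, ?_⟩
  have h1' : (p₁ * s - q₁ * r : R) = 1 := by exact_mod_cast congrArg (Int.cast (R := R)) h1
  have h2' : (p₂ * s - q₂ * r : R) = 0 := by exact_mod_cast congrArg (Int.cast (R := R)) h2
  ext i j
  rw [SL2_mul_apply]
  change y i j = unipotent _ i 0 * (!![p₁, q₁; r, s] 0 j : ℤ) +
    unipotent _ i 1 * (!![p₁, q₁; r, s] 1 j : ℤ)
  fin_cases i <;> fin_cases j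
  · simp [unipotent, hp]
    linear_combination (-p₂ * ω) * h1' + p₁ * ω * h2'
  · simp [unipotent, hq]
    linear_combination (-q₂ * ω) * h1' + q₁ * ω * h2'
  · simp [unipotent, hr]
  · simp [unipotent, hs]

theorem planeSide_unipotent_mul (k : ℤ) (a : SL2 ℤ) :
    planeSide (ι ω / 2) ((unipotent (k * ω) * a.map (Int.castRingHom R)).map ι) =
      (1 / 2 - k) * (ι ω).im := by
  have : (unipotent (k * ω) * a.map (Int.castRingHom R)).map ι =
      (unipotent (k * ω)).map ι * a.map (Int.castRingHom ℂ) := by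
    ext i j
    fin_cases i <;> fin_cases j <;> simp [SL2_mul_apply, SL2_map_apply]
  rw [this, planeSide, planeVector_mul_intCast]
  simp only [planeVector, SL2_map_apply]
  simp [unipotent]
  ring

theorem planeSide_ne_zero (hι : IsImaginaryQuadratic ι ω) (y : SL2 R) :
    planeSide (ι ω / 2) (y.map ι) ≠ 0 := by
  by_cases h : planeVector (y.map ι) 1 = 0
  · obtain ⟨k, a, rfl⟩ := hι.exists_eq_unipotent_mul h
    rw [planeSide_unipotent_mul]
    refine mul_ne_zero (fun h ↦ ?_) (by linarith [hι.one_lt_im])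
    have : (1 : ℝ) = ((2 * k : ℤ) : ℝ) := by push_cast; linarith
    have : 1 = 2 * k := by exact_mod_cast this
    omega
  · exact right_ne_zero_of_mul (hι.planeVector_mul_planeSide_pos _ h).ne'

end IsImaginaryQuadratic

/-- The image of `SL₂(ℤ)` in `PSL₂(R)`. -/
def integerHom (R : Type*) [CommRing R] : SL2 ℤ →* PSL2 R :=
  (QuotientGroup.mk' _).comp (Matrix.SpecialLinearGroup.map (Int.castRingHom R))

/-- The side of the plane of `g` on which the point at height one above `ι ω / 2` lies. -/
noncomputable def side {R : Type*} [CommRing R] (ι : R →+* ℂ) (ω : R) (g : PSL2 R) : Bool :=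
  decide (0 < planeSide (ι ω / 2) (g.out.map ι))

theorem SL2_mem_center_iff {R : Type*} [CommRing R] [IsDomain R] {c : SL2 R} :
    c ∈ Subgroup.center (SL2 R) ↔ c = 1 ∨ c = -1 := by
  constructor
  · intro hc
    obtain ⟨r, hr, h⟩ := Matrix.SpecialLinearGroup.mem_center_iff.1 hc
    rw [Fintype.card_fin, sq, mul_self_eq_one_iff] at hr
    rcases hr with rfl | rfl
    · exact Or.inl (Subtype.ext (by rw [← h, map_one]; rfl))
    · exact Or.inr (Subtype.ext (by rw [← h, map_neg, map_one]; rfl))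
  · rintro (rfl | rfl)
    · exact one_mem _
    · rw [Subgroup.mem_center_iff]
      simp

namespace IsImaginaryQuadratic

variable {R : Type*} [CommRing R] {ι : R →+* ℂ} {ω : R}

theorem planeVector_out (hι : IsImaginaryQuadratic ι ω) (y : SL2 R) :
    planeVector ((y : PSL2 R).out.map ι) = planeVector (y.map ι) := by
  obtain ⟨⟨c, hc⟩, h⟩ := QuotientGroup.mk_out_eq_mul (Subgroup.center (SL2 R)) y
  rw [h]
  have : IsDomain R := hι.injective.isDomain ι
  rcases SL2_mem_center_iff.1 hc with rfl | rfl
  · simp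
  · have : (y * -1).map ι = -y.map ι := by
      ext i j
      simp
    rw [this, planeVector_neg]

theorem side_mk (hι : IsImaginaryQuadratic ι ω) (y : SL2 R) :
    side ι ω y = decide (0 < planeSide (ι ω / 2) (y.map ι)) := by
  rw [side, decide_eq_decide, planeSide, hι.planeVector_out, planeSide]

theorem side_eq_true (hι : IsImaginaryQuadratic ι ω) (y : SL2 R) :
    side ι ω y = true ↔ 0 < planeSide (ι ω / 2) (y.map ι) := by
  rw [hι.side_mk, decide_eq_true_iff]

theorem side_eq_false (hι : IsImaginaryQuadratic ι ω) (y : SL2 R) :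
    side ι ω y = false ↔ planeSide (ι ω / 2) (y.map ι) < 0 := by
  rw [hι.side_mk, decide_eq_false_iff_not, not_lt, (hι.planeSide_ne_zero y).le_iff_lt]

theorem side_unipotent_mul (hι : IsImaginaryQuadratic ι ω) (k : ℤ) (a : SL2 ℤ) :
    side ι ω ((unipotent (k * ω) * a.map (Int.castRingHom R) : SL2 R)) = decide (k ≤ 0) := by
  have hδ : 0 < (ι ω).im := by linarith [hι.one_lt_im]
  rw [hι.side_mk, planeSide_unipotent_mul]
  congr 1
  rw [mul_pos_iff_of_pos_right hδ, eq_iff_iff]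
  constructor
  · intro h
    have : (k : ℝ) < 1 := by linarith
    have : k < 1 := by exact_mod_cast this
    omega
  · intro h
    have : (k : ℝ) ≤ 0 := by exact_mod_cast h
    linarith

theorem isEdgeSide (hι : IsImaginaryQuadratic ι ω) :
    IsEdgeSide (integerHom R).range (unipotent ω : PSL2 R) (side ι ω) where
  apply_mul g := by
    rintro _ ⟨a, rfl⟩
    obtain ⟨y, rfl⟩ := QuotientGroup.mk_surjective g
    change side ι ω ((y * a.map (Int.castRingHom R) : SL2 R)) = side ι ω y
    have : (y * a.map (Int.castRingHom R)).map ι = y.map ι * a.map (Int.castRingHom ℂ) := by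
      ext i j
      fin_cases i <;> fin_cases j <;> simp [SL2_mul_apply, SL2_map_apply]
    rw [hι.side_mk, hι.side_mk, this, planeSide, planeVector_mul_intCast, planeSide]
  one := by
    simpa [unipotent_zero] using hι.side_unipotent_mul 0 1
  stable := by
    simpa using hι.side_unipotent_mul 1 1
  adjacent g hg := by
    obtain ⟨y, rfl⟩ := QuotientGroup.mk_surjective g
    rw [← QuotientGroup.mk_mul]
    by_cases h : planeVector (y.map ι) 1 = 0
    · obtain ⟨k, a, rfl⟩ := hι.exists_eq_unipotent_mul h
      have hk : k ≠ 0 := by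
        rintro rfl
        exact hg ⟨a, by simp [integerHom, unipotent_zero]⟩
      have : unipotent ω * (unipotent (k * ω) * a.map (Int.castRingHom R)) =
          unipotent ((k + 1 : ℤ) * ω) * a.map (Int.castRingHom R) := by
        rw [← mul_assoc, unipotent_mul]
        congr 2
        push_cast
        ring
      rw [this, hι.side_unipotent_mul, hι.side_unipotent_mul]
      simp only [decide_eq_decide]
      omega
    · have h' : planeVector ((unipotent ω * y).map ι) 1 = planeVector (y.map ι) 1 := by
        simp only [planeVector, SL2_map_apply, SL2_mul_apply]
        simp [unipotent]
      have h1 := hι.planeVector_mul_planeSide_pos (ι ω / 2) h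
      have h2 := hι.planeVector_mul_planeSide_pos (ι ω / 2) (h'.symm ▸ h)
      rw [h'] at h2
      rw [hι.side_mk, hι.side_mk, decide_eq_decide]
      rcases lt_or_gt_of_ne h with h | h
      · exact iff_of_false (neg_of_mul_pos_right h2 h.le).not_gt
          (neg_of_mul_pos_right h1 h.le).not_gt
      · exact iff_of_true (pos_of_mul_pos_right h2 h.le) (pos_of_mul_pos_right h1 h.le)
  nested g hg := by
    obtain ⟨y, rfl⟩ := QuotientGroup.mk_surjective g
    have hV := mink_planeVector_self (y.map ι)
    have hV1 := mink_planeVector_self 1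
    have hV2 : mink (planeVector 1) (planeVector (y.map ι)) = planeVector (y.map ι) 2 := by
      rw [mink_planeVector, inv_one, one_mul]
    have hx : ∀ x : SL2 R, planeSide (ι ω / 2) (x.map ι) =
        -mink (pointVector (ι ω / 2) (x.map ι)) (planeVector 1) := fun x ↦ by
      rw [← planeSide_mul, mul_one]
    have hxy : ∀ x : SL2 R, planeSide (ι ω / 2) ((x * y).map ι) =
        -mink (pointVector (ι ω / 2) (x.map ι)) (planeVector (y.map ι)) := fun x ↦ by
      rw [← planeSide_mul, map_mul]
    rcases hι.one_le_or_lt_neg_one y with h | h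
    · have hM : mink (planeVector 1 - planeVector (y.map ι))
          (planeVector 1 - planeVector (y.map ι)) ≤ 0 := by
        simp only [mink_sub_left, mink_sub_right, mink_comm _ (planeVector 1)]
        linarith
      rcases isForward_or_isForward_neg hM with hF | hF
      · refine ⟨false, true, fun x ↦ ?_⟩
        obtain ⟨x, rfl⟩ := QuotientGroup.mk_surjective x
        rw [← QuotientGroup.mk_mul, hι.side_eq_true, hι.side_eq_false, hx, hxy]
        have := (isForward_pointVector (ι ω / 2) (x.map ι)).mink_nonpos hF
        rw [mink_sub_right] at this
        rintro ⟨h1, h2⟩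
        linarith
      · refine ⟨true, false, fun x ↦ ?_⟩
        obtain ⟨x, rfl⟩ := QuotientGroup.mk_surjective x
        rw [← QuotientGroup.mk_mul, hι.side_eq_true, hι.side_eq_false, hx, hxy]
        have := (isForward_pointVector (ι ω / 2) (x.map ι)).mink_nonpos hF
        rw [mink_neg_right, mink_sub_right] at this
        rintro ⟨h1, h2⟩
        linarith
    · have hM : mink (planeVector 1 + planeVector (y.map ι))
          (planeVector 1 + planeVector (y.map ι)) ≤ 0 := by
        simp only [mink_add_left, mink_add_right, mink_comm _ (planeVector 1)]
        linarith
      rcases isForward_or_isForward_neg hM with hF | hF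
      · refine ⟨false, false, fun x ↦ ?_⟩
        obtain ⟨x, rfl⟩ := QuotientGroup.mk_surjective x
        rw [← QuotientGroup.mk_mul, hι.side_eq_false, hι.side_eq_false, hx, hxy]
        have := (isForward_pointVector (ι ω / 2) (x.map ι)).mink_nonpos hF
        rw [mink_add_right] at this
        rintro ⟨h1, h2⟩
        linarith
      · refine ⟨true, true, fun x ↦ ?_⟩
        obtain ⟨x, rfl⟩ := QuotientGroup.mk_surjective x
        rw [← QuotientGroup.mk_mul, hι.side_eq_true, hι.side_eq_true, hx, hxy]
        have := (isForward_pointVector (ι ω / 2) (x.map ι)).mink_nonpos hF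
        rw [mink_neg_right, mink_add_right] at this
        rintro ⟨h1, h2⟩
        linarith

end IsImaginaryQuadratic

/-- The integer part of twice the absolute value of the Lorentz product of the standard plane with
the plane of `g`, a discrete measure of how far apart the two planes are. -/
noncomputable def planeDist {R : Type*} [CommRing R] (ι : R →+* ℂ) (g : PSL2 R) : ℕ :=
  ⌊|2 * planeVector (g.out.map ι) 2|⌋₊

theorem exists_isCoprime_of_discrim_eq_zero {a b c : ℤ} (h : b ^ 2 = 4 * a * c) :
    ∃ m n : ℤ, IsCoprime m n ∧ a * m ^ 2 + b * (m * n) + c * n ^ 2 = 0 := by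
  rcases eq_or_ne a 0 with rfl | ha
  · exact ⟨1, 0, isCoprime_one_left, by simp⟩
  have hg : Int.gcd (-b) (2 * a) ≠ 0 := by
    rw [Ne, Int.gcd_eq_zero_iff]
    omega
  obtain ⟨m, n, hmn, hm, hn⟩ := Int.exists_gcd_one (Nat.pos_of_ne_zero hg)
  refine ⟨m, n, Int.isCoprime_iff_gcd_eq_one.2 hmn, ?_⟩
  have hg' : (Int.gcd (-b) (2 * a) : ℤ) ≠ 0 := by exact_mod_cast hg
  generalize (Int.gcd (-b) (2 * a) : ℤ) = e at *
  have h0 : 2 * a * m + b * n = 0 := by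
    apply mul_right_cancel₀ hg'
    linear_combination (-2 * a) * hm - b * hn
  have : 4 * a * (a * m ^ 2 + b * (m * n) + c * n ^ 2) = 0 := by
    linear_combination (2 * a * m + b * n) * h0 - n ^ 2 * h
  simpa [ha] using this

universe u

namespace IsImaginaryQuadratic

variable {R : Type*} [CommRing R] {ι : R →+* ℂ} {ω : R}

theorem planeDist_lt (hι : IsImaginaryQuadratic ι ω) {u g : SL2 R}
    (h : |planeVector (u.map ι) 2| < |planeVector (g.map ι) 2|) :
    planeDist ι (u : PSL2 R) < planeDist ι (g : PSL2 R) := by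
  have key : ∀ y : SL2 R, (planeDist ι (y : PSL2 R) : ℝ) = 2 * |planeVector (y.map ι) 2| := by
    intro y
    obtain ⟨n, hn⟩ := hι.exists_two_mul_planeVector_two y
    rw [planeDist, hι.planeVector_out, hn, ← Int.cast_abs, Int.abs_eq_natAbs, Int.cast_natCast,
      Nat.floor_natCast, Nat.cast_natAbs, Int.cast_abs, ← hn, abs_mul, abs_two]
  have : (planeDist ι (u : PSL2 R) : ℝ) < planeDist ι (g : PSL2 R) := by
    rw [key, key]
    linarith
  exact_mod_cast this

/-- If the plane of `y` is tangent to the standard plane, then `y` lies in the subgroup generated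
by `SL₂(ℤ)` and the translation by `ω`. -/
theorem mem_closure_of_planeVector_two (hι : IsImaginaryQuadratic ι ω) {y : SL2 R}
    (hy : planeVector (y.map ι) 2 = 1) :
    (y : PSL2 R) ∈ Subgroup.closure
      (insert (unipotent ω : PSL2 R) ((integerHom R).range : Set (PSL2 R))) := by
  have hA : ∀ a : SL2 ℤ, integerHom R a ∈ Subgroup.closure
      (insert (unipotent ω : PSL2 R) ((integerHom R).range : Set (PSL2 R))) :=
    fun a ↦ Subgroup.subset_closure (Or.inr ⟨a, rfl⟩)
  have hδ : (ι ω).im ≠ 0 := by linarith [hι.one_lt_im]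
  obtain ⟨a, ha⟩ := hι.exists_planeVector_zero y
  obtain ⟨b, hb⟩ := hι.exists_planeVector_three y
  obtain ⟨c, hc⟩ := hι.exists_planeVector_one y
  have hdisc : b ^ 2 = 4 * a * c := by
    have h := mink_planeVector_self (y.map ι)
    rw [mink, hy, ha, hb, hc] at h
    have : (ι ω).im ^ 2 * ((b ^ 2 : ℤ) - (4 * a * c : ℤ)) = 0 := by
      push_cast
      linear_combination h
    have := (mul_eq_zero.1 this).resolve_left (pow_ne_zero 2 hδ)
    exact_mod_cast sub_eq_zero.1 this
  obtain ⟨m, n, ⟨u, v, huv⟩, hmn⟩ := exists_isCoprime_of_discrim_eq_zero hdisc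
  let x : SL2 ℤ := ⟨!![v, -u; m, n], by rw [Matrix.det_fin_two_of]; linarith⟩
  have hV : planeVector ((x.map (Int.castRingHom R) * y).map ι) 1 = 0 := by
    have h1 : planeVector ((x.map (Int.castRingHom R) * y).map ι) 1 =
        planeVector (y.map ι) 0 * m ^ 2 + planeVector (y.map ι) 3 * (m * n) +
          planeVector (y.map ι) 1 * n ^ 2 := by
      simp only [planeVector, SL2_map_apply, SL2_mul_apply]
      simp [x]
      ring
    have h2 : (a * m ^ 2 + b * (m * n) + c * n ^ 2 : ℝ) = 0 := by exact_mod_cast hmn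
    rw [h1, ha, hb, hc]
    linear_combination (ι ω).im * h2
  obtain ⟨k, a', h⟩ := hι.exists_eq_unipotent_mul hV
  have h' : (y : PSL2 R) = (integerHom R x)⁻¹ * ((unipotent ω : PSL2 R) ^ k * integerHom R a') := by
    rw [eq_inv_mul_iff_mul_eq, ← QuotientGroup.mk_zpow, unipotent_zpow]
    exact congrArg (QuotientGroup.mk : SL2 R → PSL2 R) h
  have ht : (unipotent ω : PSL2 R) ∈ Subgroup.closure
      (insert (unipotent ω : PSL2 R) ((integerHom R).range : Set (PSL2 R))) :=
    Subgroup.subset_closure (Set.mem_insert _ _)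
  rw [h']
  exact mul_mem (inv_mem (hA x)) (mul_mem (zpow_mem ht k) (hA a'))

theorem sign_smul_mink {z : ℂ} (hι : IsImaginaryQuadratic ι ω) (hz : z = ι ω / 2) {x g : SL2 R}
    {a : Bool} : (side ι ω ((x * g : SL2 R)) = a →
      mink (pointVector z (x.map ι)) ((if a then (1 : ℝ) else -1) • planeVector (g.map ι)) < 0) ∧
      ((side ι ω ((x * g : SL2 R)) = !a) →
      0 < mink (pointVector z (x.map ι)) ((if a then (1 : ℝ) else -1) • planeVector (g.map ι))) := by
  subst hz
  have h := planeSide_mul (ι ω / 2) (x.map ι) (g.map ι)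
  rw [← map_mul] at h
  rw [mink_smul_right]
  cases a
  · simp only [Bool.not_false, hι.side_eq_true, hι.side_eq_false]
    constructor <;> intro h' <;> simp <;> linarith
  · simp only [Bool.not_true, hι.side_eq_true, hι.side_eq_false]
    constructor <;> intro h' <;> simp <;> linarith

theorem one_le_abs_planeVector_two (hι : IsImaginaryQuadratic ι ω) (y : SL2 R) :
    1 ≤ |planeVector (y.map ι) 2| := by
  rcases hι.one_le_or_lt_neg_one y with h | h
  · exact le_abs.2 (Or.inl h)
  · exact le_abs.2 (Or.inr (by linarith))

theorem mem_closure_insert_vertexStabilizer (hι : IsImaginaryQuadratic ι ω) (g : PSL2 R) :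
    g ∈ Subgroup.closure
      (insert (unipotent ω : PSL2 R) (vertexStabilizer (side ι ω) : Set (PSL2 R))) := by
  refine hι.isEdgeSide.mem_closure_of_between (planeDist ι) (fun g ↦ ?_) g
  obtain ⟨g, rfl⟩ := QuotientGroup.mk_surjective g
  by_cases hg : planeVector (g.map ι) 2 = 1
  · exact Or.inl (hι.mem_closure_of_planeVector_two hg)
  right
  intro u a b c x₁ x₂ x₃ x₄ h1v h1u h1w h2v h2u h2w h3v h3u h3w h4v h4u h4w
  obtain ⟨u, rfl⟩ := QuotientGroup.mk_surjective u
  obtain ⟨x₁, rfl⟩ := QuotientGroup.mk_surjective x₁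
  obtain ⟨x₂, rfl⟩ := QuotientGroup.mk_surjective x₂
  obtain ⟨x₃, rfl⟩ := QuotientGroup.mk_surjective x₃
  obtain ⟨x₄, rfl⟩ := QuotientGroup.mk_surjective x₄
  have habs : ∀ a : Bool, |(if a then (1 : ℝ) else -1)| = 1 := by simp
  have hself : ∀ (a : Bool) (y : SL2 R),
      mink ((if a then (1 : ℝ) else -1) • planeVector (y.map ι))
        ((if a then (1 : ℝ) else -1) • planeVector (y.map ι)) = 1 := fun a y ↦ by
    rw [mink_smul_left, mink_smul_right, mink_planeVector_self]
    cases a <;> simp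
  have hmink : ∀ (a b : Bool) (y y' : SL2 R),
      |mink ((if a then (1 : ℝ) else -1) • planeVector (y.map ι))
        ((if b then (1 : ℝ) else -1) • planeVector (y'.map ι))| =
        |planeVector ((y⁻¹ * y').map ι) 2| := fun a b y y' ↦ by
    rw [mink_smul_left, mink_smul_right, mink_planeVector, abs_mul, abs_mul, habs, habs, one_mul,
      one_mul, map_mul, map_inv]
  have hgne : |planeVector ((1⁻¹ * g).map ι) 2| ≠ 1 := by
    rw [inv_one, one_mul]
    intro h
    rcases hι.one_le_or_lt_neg_one g with h' | h'
    · exact hg (by rwa [abs_of_nonneg (by linarith)] at h)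
    · rw [abs_of_neg (by linarith)] at h
      linarith
  have hF := fun x : SL2 R ↦ isForward_pointVector (ι ω / 2) (x.map ι)
  rw [← mul_one x₁] at h1v
  rw [← mul_one x₂] at h2v
  rw [← mul_one x₄] at h4v
  have key := abs_mink_lt_of_between (hself a 1) (hself b u) (hself c g)
    (by rw [hmink]; exact hι.one_le_abs_planeVector_two _)
    (by rw [hmink]; exact hι.one_le_abs_planeVector_two _)
    (by rwa [hmink]) (hF x₁) (hF x₂) (hF x₃) (hF x₄)
    ((hι.sign_smul_mink rfl).2 h1v) ((hι.sign_smul_mink rfl).2 h1u)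
    ((hι.sign_smul_mink rfl).2 h1w) ((hι.sign_smul_mink rfl).1 h2v)
    ((hι.sign_smul_mink rfl).2 h2u) ((hι.sign_smul_mink rfl).1 h3u)
    ((hι.sign_smul_mink rfl).2 h3w) ((hι.sign_smul_mink rfl).1 h4v)
    ((hι.sign_smul_mink rfl).1 h4u) ((hι.sign_smul_mink rfl).1 h4w)
  rw [hmink, hmink, hmink, inv_one, one_mul, one_mul] at key
  exact ⟨hι.planeDist_lt key.1, hι.planeDist_lt key.2⟩

/-- The image of `SL₂(ℤ)` in `PSL₂(R)` is `PSL₂(ℤ)`. -/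
theorem nonempty_range_integerHom_mulEquiv (hι : IsImaginaryQuadratic ι ω) :
    Nonempty ((integerHom R).range ≃* PSL2 ℤ) := by
  have hker : (integerHom R).ker = Subgroup.center (SL2 ℤ) := by
    have : IsDomain R := hι.injective.isDomain ι
    have hcast : Function.Injective (Int.castRingHom R) := fun m n h ↦ by
      simpa using congrArg ι h
    have hmap : Function.Injective (Matrix.SpecialLinearGroup.map (n := Fin 2)
        (Int.castRingHom R)) := fun x y h ↦ by
      ext i j
      exact hcast (congrArg (fun w : SL2 R ↦ w i j) h)
    have hneg : (-1 : SL2 ℤ).map (Int.castRingHom R) = -1 := by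
      ext i j
      fin_cases i <;> fin_cases j <;> simp
    ext x
    rw [MonoidHom.mem_ker]
    change (x.map (Int.castRingHom R) : PSL2 R) = 1 ↔ _
    rw [QuotientGroup.eq_one_iff, SL2_mem_center_iff, SL2_mem_center_iff, ← hneg, hmap.eq_iff,
      ← map_one (Matrix.SpecialLinearGroup.map (n := Fin 2) (Int.castRingHom R)), hmap.eq_iff]
  exact ⟨(QuotientGroup.quotientKerEquivRange (integerHom R)).symm.trans
    (QuotientGroup.quotientMulEquivOfEq hker)⟩

/-- `PSL₂(R)` is an HNN extension with associated subgroup `PSL₂(ℤ)`. -/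
theorem exists_hnnExtension {R : Type} [CommRing R] {ι : R →+* ℂ} {ω : R}
    (hι : IsImaginaryQuadratic ι ω) : ∃ (H : GrpCat.{u}) (A B : Subgroup H) (φ : A ≃* B),
      Nonempty (A ≃* PSL2 ℤ) ∧ Nonempty (PSL2 R ≃* HNNExtension H A B φ) := by
  obtain ⟨A, B, φ, ⟨e⟩, h⟩ := hι.isEdgeSide.exists_hnnExtension
    hι.mem_closure_insert_vertexStabilizer
    (MulEquiv.ulift : ULift.{u} (vertexStabilizer (side ι ω)) ≃* _)
  obtain ⟨e'⟩ := hι.nonempty_range_integerHom_mulEquiv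
  exact ⟨GrpCat.of (ULift.{u} (vertexStabilizer (side ι ω))), A, B, φ, ⟨e.trans e'⟩, h⟩

end IsImaginaryQuadratic

theorem Squarefree.exists_int_of_mul_sq {d : ℕ} (hd : Squarefree d) {q : ℚ} {k : ℤ}
    (h : d * q ^ 2 = k) : ∃ n : ℤ, q = n := by
  have h' : (d : ℤ) * q.num ^ 2 = k * (q.den : ℤ) ^ 2 := by
    have hq : (q.den : ℚ) ≠ 0 := by exact_mod_cast q.den_nz
    have : (d : ℚ) * q.num ^ 2 = k * (q.den : ℚ) ^ 2 := by
      rw [← h, ← Rat.mul_den_eq_num]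
      ring
    exact_mod_cast this
  have hdvd : q.den * q.den ∣ d := by
    have : q.den ^ 2 ∣ d * q.num.natAbs ^ 2 := by
      have := congrArg Int.natAbs h'
      rw [Int.natAbs_mul, Int.natAbs_mul, Int.natAbs_pow, Int.natAbs_pow, Int.natAbs_natCast,
        Int.natAbs_natCast] at this
      exact ⟨k.natAbs, by rw [this, mul_comm]⟩
    rw [← sq]
    exact Nat.Coprime.dvd_of_dvd_mul_right (q.reduced.symm.pow 2 2) this
  exact ⟨q.num, ((Rat.den_eq_one_iff q).1 (Nat.isUnit_iff.1 (hd _ hdvd))).symm⟩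

theorem I_mul_sqrt_sq (d : ℕ) : (Complex.I * (Real.sqrt d : ℂ)) ^ 2 = -d := by
  have h : ((Real.sqrt d : ℝ) : ℂ) ^ 2 = d := by
    exact_mod_cast Real.sq_sqrt (Nat.cast_nonneg d)
  rw [mul_pow, Complex.I_sq, h, neg_one_mul]

theorem exists_eq_of_mem_Qd {d : ℕ} (hd : 0 < d) {x : ℂ} (hx : x ∈ Qd d) :
    ∃ a b : ℚ, x = a + b * (Complex.I * (Real.sqrt d : ℂ)) := by
  have hs := I_mul_sqrt_sq d
  induction hx using IntermediateField.adjoin_induction with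
  | mem x hx =>
    rw [Set.mem_singleton_iff] at hx
    exact ⟨0, 1, by simp [hx]⟩
  | algebraMap q => exact ⟨q, 0, by simp⟩
  | add x y _ _ hx hy =>
    obtain ⟨a, b, rfl⟩ := hx
    obtain ⟨a', b', rfl⟩ := hy
    exact ⟨a + a', b + b', by push_cast; ring⟩
  | inv x _ hx =>
    obtain ⟨a, b, rfl⟩ := hx
    by_cases h : a ^ 2 + d * b ^ 2 = 0
    · have hd' : (0 : ℚ) < d := by exact_mod_cast hd
      have ha : a = 0 := by nlinarith [sq_nonneg a, mul_nonneg hd'.le (sq_nonneg b)]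
      have hb : b = 0 := by simpa [ha, hd.ne'] using h
      exact ⟨0, 0, by simp [ha, hb]⟩
    · refine ⟨a / (a ^ 2 + d * b ^ 2), -b / (a ^ 2 + d * b ^ 2), ?_⟩
      have h' : (a : ℂ) ^ 2 + d * b ^ 2 ≠ 0 := by exact_mod_cast h
      apply inv_eq_of_mul_eq_one_right
      push_cast
      rw [div_mul_eq_mul_div, ← add_div, mul_div_assoc', div_eq_one_iff_eq h']
      linear_combination (-(b : ℂ) ^ 2) * hs
  | mul x y _ _ hx hy =>
    obtain ⟨a, b, rfl⟩ := hx
    obtain ⟨a', b', rfl⟩ := hy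
    exact ⟨a * a' - d * (b * b'), a * b' + b * a', by
      push_cast; linear_combination ((b : ℂ) * b') * hs⟩

/-- The embedding of `O_d` into the complex numbers. -/
noncomputable def complexEmbedding (d : ℕ) : Od d →+* ℂ :=
  (algebraMap (Qd d) ℂ).comp (algebraMap (Od d) (Qd d))

theorem complexEmbedding_injective (d : ℕ) : Function.Injective (complexEmbedding d) :=
  (algebraMap (Qd d) ℂ).injective.comp NumberField.RingOfIntegers.coe_injective

theorem exists_int_of_isIntegral {q : ℚ} (h : IsIntegral ℤ (q : ℂ)) : ∃ n : ℤ, q = n := by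
  have h' : IsIntegral ℤ (algebraMap ℚ ℂ q) := by simpa using h
  obtain ⟨n, hn⟩ := IsIntegrallyClosed.isIntegral_iff.1
    ((isIntegral_algebraMap_iff (algebraMap ℚ ℂ).injective).1 h')
  exact ⟨n, by simpa using hn.symm⟩

theorem complexEmbedding_exists_eq {d : ℕ} (hd : Squarefree d) (x : Od d) :
    ∃ A B N : ℤ, A ^ 2 + d * B ^ 2 = 4 * N ∧
      2 * complexEmbedding d x = A + B * (Complex.I * (Real.sqrt d : ℂ)) := by
  have hs := I_mul_sqrt_sq d
  obtain ⟨a, b, hab⟩ := exists_eq_of_mem_Qd hd.ne_zero.bot_lt (x : Qd d).2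
  have hx : complexEmbedding d x = a + b * (Complex.I * (Real.sqrt d : ℂ)) := hab
  have hint : IsIntegral ℤ (complexEmbedding d x) :=
    map_isIntegral_int (algebraMap (Qd d) ℂ) x.isIntegral_coe
  have hconj := map_isIntegral_int (starRingEnd ℂ) hint
  have hx' : conj (complexEmbedding d x) = a - b * (Complex.I * (Real.sqrt d : ℂ)) := by
    simp [hx]
    ring
  obtain ⟨A, hA⟩ : ∃ A : ℤ, 2 * a = A := by
    apply exists_int_of_isIntegral
    have : ((2 * a : ℚ) : ℂ) = complexEmbedding d x + conj (complexEmbedding d x) := by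
      rw [hx', hx]
      push_cast
      ring
    exact this ▸ hint.add hconj
  obtain ⟨N, hN⟩ : ∃ N : ℤ, a ^ 2 + d * b ^ 2 = N := by
    apply exists_int_of_isIntegral
    have : ((a ^ 2 + d * b ^ 2 : ℚ) : ℂ) =
        complexEmbedding d x * conj (complexEmbedding d x) := by
      rw [hx', hx]
      push_cast
      linear_combination ((b : ℂ) ^ 2) * hs
    exact this ▸ hint.mul hconj
  obtain ⟨B, hB⟩ : ∃ B : ℤ, 2 * b = B := by
    apply hd.exists_int_of_mul_sq (k := 4 * N - A ^ 2)
    push_cast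
    rw [← hA, ← hN]
    ring
  refine ⟨A, B, N, ?_, ?_⟩
  · have : (A : ℚ) ^ 2 + d * B ^ 2 = 4 * N := by
      rw [← hA, ← hN, ← hB]
      ring
    exact_mod_cast this
  · have hA' : (2 * a : ℂ) = A := by exact_mod_cast congrArg (Rat.cast : ℚ → ℂ) hA
    have hB' : (2 * b : ℂ) = B := by exact_mod_cast congrArg (Rat.cast : ℚ → ℂ) hB
    rw [hx, ← hA', ← hB']
    ring

theorem exists_complexEmbedding_eq {d : ℕ} {z : ℂ} (hz : z ∈ Qd d) (h : IsIntegral ℤ z) :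
    ∃ ω : Od d, complexEmbedding d ω = z :=
  ⟨⟨⟨z, hz⟩, (isIntegral_algebraMap_iff (B := ℂ) (algebraMap (Qd d) ℂ).injective).1 h⟩, rfl⟩

theorem exists_isImaginaryQuadratic_of_mod_four_ne {d : ℕ} (hd : Squarefree d) (h1 : d ≠ 1)
    (h4 : d % 4 ≠ 3) : ∃ ω, IsImaginaryQuadratic (complexEmbedding d) ω := by
  have hd0 : d % 4 ≠ 0 := fun h ↦ by
    have := Nat.isUnit_iff.1 (hd 2 (by omega))
    omega
  have hpos := hd.ne_zero.bot_lt
  have hs := I_mul_sqrt_sq d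
  obtain ⟨ω, hω⟩ := exists_complexEmbedding_eq (d := d) (mem_adjoin_simple_self ℚ _)
    (by
      refine IsIntegral.of_pow two_pos ?_
      rw [hs]
      exact (isIntegral_algebraMap (x := (d : ℤ))).neg)
  have him : (complexEmbedding d ω).im = Real.sqrt d := by simp [hω]
  refine ⟨ω, complexEmbedding_injective d, fun x ↦ ?_, ?_, 4 * d, ?_⟩
  · obtain ⟨A, B, N, hN, hx⟩ := complexEmbedding_exists_eq hd x
    have hAB : A % 2 = 0 ∧ B % 2 = 0 := by
      have hd' : (d : ℤ) % 4 = 1 ∨ (d : ℤ) % 4 = 2 := by omega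
      have key : (A ^ 2 + d * B ^ 2) % 4 = 0 := by omega
      have hA : A % 4 = 0 ∨ A % 4 = 1 ∨ A % 4 = 2 ∨ A % 4 = 3 := by omega
      have hB : B % 4 = 0 ∨ B % 4 = 1 ∨ B % 4 = 2 ∨ B % 4 = 3 := by omega
      rw [sq, sq, Int.add_emod, Int.mul_emod, Int.mul_emod (d : ℤ), Int.mul_emod B] at key
      rcases hd' with h | h <;> rcases hA with hA | hA | hA | hA <;>
        rcases hB with hB | hB | hB | hB <;> rw [h, hA, hB] at key <;> omega
    obtain ⟨m, rfl⟩ := Int.dvd_of_emod_eq_zero hAB.1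
    obtain ⟨n, rfl⟩ := Int.dvd_of_emod_eq_zero hAB.2
    refine ⟨m, n, complexEmbedding_injective d ?_⟩
    rw [map_add, map_mul, map_intCast, map_intCast, hω]
    push_cast at hx
    linear_combination hx / 2
  · rw [him, Real.lt_sqrt zero_le_one, one_pow]
    exact_mod_cast (by omega : 1 < d)
  · rw [him, Real.sq_sqrt (Nat.cast_nonneg d)]
    push_cast
    rfl

theorem exists_isImaginaryQuadratic_of_mod_four_eq {d : ℕ} (hd : Squarefree d) (h3 : d ≠ 3)
    (h4 : d % 4 = 3) : ∃ ω, IsImaginaryQuadratic (complexEmbedding d) ω := by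
  have hs := I_mul_sqrt_sq d
  obtain ⟨k, hk⟩ : ∃ k : ℕ, d + 1 = 4 * k := ⟨(d + 1) / 4, by omega⟩
  have hk' : (d : ℂ) + 1 = 4 * k := by exact_mod_cast hk
  obtain ⟨ω, hω⟩ := exists_complexEmbedding_eq (d := d)
    (z := (1 + Complex.I * (Real.sqrt d : ℂ)) / 2)
    (div_mem (add_mem (one_mem _) (mem_adjoin_simple_self ℚ _)) (ofNat_mem _ 2))
    (by
      refine ⟨.X ^ 2 - .X + .C (k : ℤ), by monicity!, ?_⟩
      simp only [Polynomial.eval₂_add, Polynomial.eval₂_sub, Polynomial.eval₂_pow,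
        Polynomial.eval₂_X, eq_intCast, Int.cast_natCast, Polynomial.eval₂_natCast]
      linear_combination hs / 4 - hk' / 4)
  have him : (complexEmbedding d ω).im = Real.sqrt d / 2 := by simp [hω]
  refine ⟨ω, complexEmbedding_injective d, fun x ↦ ?_, ?_, d, ?_⟩
  · obtain ⟨A, B, N, hN, hx⟩ := complexEmbedding_exists_eq hd x
    obtain ⟨m, hm⟩ : (2 : ℤ) ∣ A - B := by
      have h : Even (A ^ 2 + d * B ^ 2) := ⟨2 * N, by omega⟩
      have hd' : ¬ Even (d : ℤ) := by
        rw [Int.even_iff]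
        omega
      have : Even (A - B) := by
        rw [Int.even_add, Int.even_mul, Int.even_pow' two_ne_zero, Int.even_pow' two_ne_zero] at h
        rw [Int.even_sub]
        tauto
      exact this.two_dvd
    refine ⟨m, B, complexEmbedding_injective d ?_⟩
    have hm' : (A : ℂ) - B = 2 * m := by exact_mod_cast hm
    rw [map_add, map_mul, map_intCast, map_intCast, hω]
    linear_combination hx / 2 + hm' / 2
  · rw [him, lt_div_iff₀ two_pos, one_mul, Real.lt_sqrt zero_le_two]
    have : 4 < d := by omega
    have : (4 : ℝ) < d := by exact_mod_cast this
    linarith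
  · rw [him, div_pow, Real.sq_sqrt (Nat.cast_nonneg d)]
    push_cast
    ring

/-- For every squarefree positive integer `d ∉ {1, 3}`, the Bianchi group `PSL₂(O_d)` is
an HNN extension whose amalgamated (associated) subgroup is isomorphic to `PSL₂(ℤ)`. -/
theorem bianchi_hnn_extension (d : ℕ) (hd : Squarefree d) (hd0 : 0 < d)
    (h1 : d ≠ 1) (h3 : d ≠ 3) :
    ∃ (H : GrpCat) (A B : Subgroup H) (φ : A ≃* B),
      Nonempty (A ≃* PSL2 ℤ) ∧
      Nonempty (PSL2 (Od d) ≃* HNNExtension H A B φ) := by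
  obtain ⟨ω, hω⟩ : ∃ ω, IsImaginaryQuadratic (complexEmbedding d) ω := by
    by_cases h4 : d % 4 = 3
    · exact exists_isImaginaryQuadratic_of_mod_four_eq hd h3 h4
    · exact exists_isImaginaryQuadratic_of_mod_four_ne hd h1 h4
  exact hω.exists_hnnExtension
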